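/- Let G be a finite simple graph with independence number 3, let a₁ be the number of vertices of G, a₂ the number of 2-element independent sets, and a₃ the number of 3-element independent sets, and let P(z) = a₁z + a₂z² + a₃z³ as a map ℂ → ℂ. If a₁ ≥ 4 and 4·a₃·(a₁ − 1)·(a₁ − 2) < a₂²·(a₁ − 2) < a₃·(2a₁ − 3)², then the Julia set J(P) is not connected, but it is not totally disconnected (it contains a connected subset with at least two distinct points). -/

import Mathlib

/-- A nowhere vanishing continuous function on the plane has a continuous logarithm. -/
theorem exists_continuous_exp_eq {g : ℂ → ℂ} (hg : Continuous g) (hg0 : ∀ z, g z ≠ 0) :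
    ∃ f : ℂ → ℂ, Continuous f ∧ ∀ z, Complex.exp (f z) = g z := by
  obtain ⟨f, ⟨-, hf⟩, -⟩ := Complex.isCoveringMapOn_exp.existsUnique_continuousMap_lifts ⟨g, hg⟩
    (a₀ := 0) (Complex.exp_log (hg0 0)) hg0
  exact ⟨f, f.continuous, congrFun hf⟩

/-- On a circle centred at `p` there is no logarithm of `z - p` that extends continuously to the
plane. -/
theorem not_exists_continuous_exp_eq_sub_of_norm_eq (p : ℂ) {R : ℝ} (hR : 0 < R) {f : ℂ → ℂ}
    (hf : Continuous f) : ¬ ∀ z, ‖z - p‖ = R → Complex.exp (f z) = z - p := by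
  intro h
  have hexp (t : ℝ) : Complex.exp (f (p + R * Complex.exp (t * Complex.I))) =
      R * Complex.exp (t * Complex.I) := by
    rw [h _ (by simp [Complex.norm_exp_ofReal_mul_I, abs_of_pos hR])]
    ring
  have h0 : Complex.exp (f (p + R)) = R := by simpa using hexp 0
  have key : (fun t : ℝ => f (p + R * Complex.exp (t * Complex.I))) =
      fun t : ℝ => f (p + R) + t * Complex.I := by
    refine Complex.isCoveringMap_exp.eq_of_comp_eq (by fun_prop) (by fun_prop) ?_ 0 (by simp)
    funext t
    simp only [Function.comp_apply, Subtype.mk.injEq]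
    rw [hexp, Complex.exp_add, h0]
  have h2 := congrFun key (2 * Real.pi)
  simp [Complex.exp_two_pi_mul_I, Real.pi_ne_zero] at h2

/-- On a compact totally disconnected subset of the punctured plane there is a continuous
logarithm, and it is the restriction of a continuous function on the plane. -/
theorem exists_continuous_exp_eq_sub_of_isTotallyDisconnected {J : Set ℂ} (hJ : IsCompact J)
    (hJd : IsTotallyDisconnected J) {p : ℂ} (hp : p ∉ J) :
    ∃ L : ℂ → ℂ, Continuous L ∧ ∀ z ∈ J, Complex.exp (L z) = z - p := by
  classical
  have : CompactSpace J := isCompact_iff_compactSpace.mp hJ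
  have : TotallyDisconnectedSpace J := totallyDisconnectedSpace_subtype_iff.mpr hJd
  have hne (z : J) : (z : ℂ) - p ≠ 0 := fun h => hp (sub_eq_zero.mp h ▸ z.2)
  obtain ⟨C, hC, hZC, hCU⟩ := exists_clopen_of_closed_subset_open
    (Z := {z : J | (z : ℂ) - p ∉ Complex.slitPlane})
    (U := {z : J | -((z : ℂ) - p) ∈ Complex.slitPlane})
    ((Complex.isOpen_slitPlane.preimage
      (by fun_prop : Continuous fun z : J => (z : ℂ) - p)).isClosed_compl)
    (Complex.isOpen_slitPlane.preimage (by fun_prop : Continuous fun z : J => -((z : ℂ) - p)))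
    (fun z hz => (Complex.mem_slitPlane_or_neg_mem_slitPlane (hne z)).resolve_left hz)
  have hcont : Continuous (C.piecewise
      (fun z : J => Complex.log (-((z : ℂ) - p)) + Real.pi * Complex.I)
      fun z : J => Complex.log ((z : ℂ) - p)) := by
    refine continuous_piecewise (by simp [hC.frontier_eq]) ?_ ?_
    · rw [hC.isClosed.closure_eq]
      exact (ContinuousOn.clog (by fun_prop) fun z hz => hCU hz).add continuousOn_const
    · rw [hC.compl.isClosed.closure_eq]
      exact ContinuousOn.clog (by fun_prop) fun z hz => not_not.mp fun h => hz (hZC h)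
  obtain ⟨L, hL⟩ := ContinuousMap.exists_restrict_eq hJ.isClosed ⟨_, hcont⟩
  refine ⟨L, L.continuous, fun z hz => ?_⟩
  have hLz := DFunLike.congr_fun hL ⟨z, hz⟩
  simp only [ContinuousMap.restrict_apply, ContinuousMap.coe_mk] at hLz
  rw [hLz]
  by_cases hzC : (⟨z, hz⟩ : J) ∈ C
  · rw [Set.piecewise_eq_of_mem _ _ _ hzC, Complex.exp_add, Complex.exp_pi_mul_I,
      Complex.exp_log (neg_ne_zero.mpr (hne ⟨z, hz⟩))]
    ring
  · rw [Set.piecewise_eq_of_notMem _ _ _ hzC, Complex.exp_log (hne ⟨z, hz⟩)]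

/-- The frontier of a compact subset of the plane with nonempty interior is not totally
disconnected. -/
theorem IsCompact.not_isTotallyDisconnected_frontier {K : Set ℂ} (hK : IsCompact K)
    (hint : (interior K).Nonempty) : ¬ IsTotallyDisconnected (frontier K) := by
  classical
  intro hd
  obtain ⟨p, hp⟩ := hint
  obtain ⟨L, hLc, hL⟩ := exists_continuous_exp_eq_sub_of_isTotallyDisconnected
    (hK.of_isClosed_subset isClosed_frontier hK.isClosed.frontier_subset) hd
    (fun h => h.2 hp)
  have hg : Continuous (K.piecewise (fun z => Complex.exp (L z)) fun z => z - p) :=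
    Continuous.piecewise hL (by fun_prop) (by fun_prop)
  obtain ⟨f, hf, hfg⟩ := exists_continuous_exp_eq hg (by
      intro z hz
      by_cases hzK : z ∈ K
      · rw [Set.piecewise_eq_of_mem _ _ _ hzK] at hz
        exact Complex.exp_ne_zero _ hz
      · rw [Set.piecewise_eq_of_notMem _ _ _ hzK, sub_eq_zero] at hz
        exact hzK (hz ▸ interior_subset hp))
  obtain ⟨R, hR, hKR⟩ := hK.isBounded.subset_ball_lt 0 p
  refine not_exists_continuous_exp_eq_sub_of_norm_eq p hR hf fun z hz => ?_
  have hzK : z ∉ K := fun h => by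
    have := hKR h
    rw [mem_ball_iff_norm] at this
    exact this.ne hz
  simpa [hzK] using hfg z

/-- A relatively clopen nonempty part of a compact set in the plane meets its frontier. -/
theorem IsCompact.frontier_inter_nonempty {K A : Set ℂ} (hK : IsCompact K) (hA : IsOpen A)
    (hKA : IsClosed (K ∩ A)) (hne : (K ∩ A).Nonempty) : (frontier K ∩ A).Nonempty := by
  by_contra hempty
  rw [Set.not_nonempty_iff_eq_empty] at hempty
  have hint : K ∩ A = interior K ∩ A := by
    refine Set.Subset.antisymm (fun z hz => ⟨?_, hz.2⟩)
      (Set.inter_subset_inter_left _ interior_subset)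
    by_contra hzi
    exact Set.eq_empty_iff_forall_notMem.mp hempty z ⟨⟨subset_closure hz.1, hzi⟩, hz.2⟩
  have hclopen : IsClopen (K ∩ A) := ⟨hKA, hint ▸ isOpen_interior.inter hA⟩
  rcases isClopen_iff.mp hclopen with h | h
  · exact hne.ne_empty h
  · exact noncompact_univ ℂ (h ▸ hK.of_isClosed_subset hKA Set.inter_subset_left)

/-- If two disjoint open sets separate a compact set in the plane, they separate its frontier. -/
theorem IsCompact.not_isPreconnected_frontier {K A B : Set ℂ} (hK : IsCompact K) (hA : IsOpen A)
    (hB : IsOpen B) (hAB : Disjoint A B) (hKAB : K ⊆ A ∪ B) (hKA : (K ∩ A).Nonempty)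
    (hKB : (K ∩ B).Nonempty) : ¬ IsPreconnected (frontier K) := by
  intro hpre
  have hclosed {A B : Set ℂ} (hB : IsOpen B) (hAB : Disjoint A B) (hKAB : K ⊆ A ∪ B) :
      IsClosed (K ∩ A) := by
    have : K ∩ A = K ∩ Bᶜ := by
      ext z
      exact ⟨fun h => ⟨h.1, hAB.notMem_of_mem_left h.2⟩,
        fun h => ⟨h.1, (hKAB h.1).resolve_right h.2⟩⟩
    exact this ▸ hK.isClosed.inter hB.isClosed_compl
  obtain ⟨z, -, hzA, hzB⟩ := hpre A B hA hB (hK.isClosed.frontier_subset.trans hKAB)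
    (hK.frontier_inter_nonempty hA (hclosed hB hAB hKAB) hKA)
    (hK.frontier_inter_nonempty hB (hclosed hA hAB.symm (Set.union_comm A B ▸ hKAB)) hKB)
  exact Set.disjoint_left.mp hAB hzA hzB

/-- The filled-in Julia set: the points with bounded forward orbit. -/
def filledJulia (P : ℂ → ℂ) : Set ℂ :=
  {z | Bornology.IsBounded (Set.range fun n => P^[n] z)}

theorem mem_filledJulia_iff {P : ℂ → ℂ} {z : ℂ} :
    z ∈ filledJulia P ↔ ∃ C, ∀ n, ‖P^[n] z‖ ≤ C := by
  simp [filledJulia, isBounded_iff_forall_norm_le]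

theorem mem_filledJulia_of_isFixedPt {P : ℂ → ℂ} {z : ℂ} (hz : Function.IsFixedPt P z) :
    z ∈ filledJulia P :=
  mem_filledJulia_iff.mpr ⟨‖z‖, fun n => by rw [(hz.iterate n).eq]⟩

theorem mem_filledJulia_of_apply_eq {P : ℂ → ℂ} {z w : ℂ} (hz : z ∈ filledJulia P)
    (h : P z = P w) : w ∈ filledJulia P := by
  obtain ⟨C, hC⟩ := mem_filledJulia_iff.mp hz
  refine mem_filledJulia_iff.mpr ⟨max C ‖w‖, fun n => ?_⟩
  cases n with
  | zero => exact le_max_right _ _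
  | succ n =>
    rw [Function.iterate_succ_apply, ← h, ← Function.iterate_succ_apply]
    exact (hC _).trans (le_max_left _ _)

theorem isCompact_filledJulia {P : ℂ → ℂ} (hP : Continuous P) {R : ℝ} (hR : 0 ≤ R)
    (hesc : ∀ z, R < ‖z‖ → 2 * ‖z‖ ≤ ‖P z‖) : IsCompact (filledJulia P) := by
  have heq : filledJulia P = ⋂ n, {z | ‖P^[n] z‖ ≤ R} := by
    ext z
    simp only [Set.mem_iInter, Set.mem_ofPred_eq]
    refine ⟨fun hz m => ?_, fun h => mem_filledJulia_iff.mpr ⟨R, h⟩⟩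
    obtain ⟨C, hC⟩ := mem_filledJulia_iff.mp hz
    by_contra! hm
    have hgrow (n : ℕ) : 2 ^ n * ‖P^[m] z‖ ≤ ‖P^[n + m] z‖ := by
      induction n with
      | zero => simp
      | succ n ih =>
        have h1 : ‖P^[m] z‖ ≤ 2 ^ n * ‖P^[m] z‖ :=
          le_mul_of_one_le_left (norm_nonneg _) (one_le_pow₀ one_le_two)
        have h2 := hesc (P^[n + m] z) (by linarith)
        rw [Nat.add_right_comm, Function.iterate_succ_apply', pow_succ]
        linarith
    have hpos : 0 < ‖P^[m] z‖ := hR.trans_lt hm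
    obtain ⟨n, hn⟩ := pow_unbounded_of_one_lt (C / ‖P^[m] z‖) one_lt_two
    rw [div_lt_iff₀ hpos] at hn
    linarith [hgrow n, hC (n + m)]
  refine Metric.isCompact_of_isClosed_isBounded ?_ ?_
  · rw [heq]
    exact isClosed_iInter fun n => isClosed_le (hP.iterate n).norm continuous_const
  · refine isBounded_iff_forall_norm_le.mpr ⟨R, fun z hz => ?_⟩
    rw [heq] at hz
    exact Set.mem_iInter.mp hz 0

/-- A fixed point near which `P` does not increase distances to the point is interior to the
filled-in Julia set. -/
theorem interior_filledJulia_nonempty {P : ℂ → ℂ} {q : ℂ} {ε : ℝ} (hε : 0 < ε)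
    (h : ∀ z ∈ Metric.ball q ε, ‖P z - q‖ ≤ ‖z - q‖) : (interior (filledJulia P)).Nonempty := by
  refine ⟨q, mem_interior.mpr ⟨Metric.ball q ε, fun z hz => ?_, Metric.isOpen_ball,
    Metric.mem_ball_self hε⟩⟩
  have hmem (n : ℕ) : P^[n] z ∈ Metric.ball q ε := by
    induction n with
    | zero => exact hz
    | succ n ih =>
      rw [Function.iterate_succ_apply', mem_ball_iff_norm]
      exact (h _ ih).trans_lt (mem_ball_iff_norm.mp ih)
  exact Metric.isBounded_ball.subset (Set.range_subset_iff.mpr hmem)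

/-- Real points moved to the left by a definite amount escape to infinity. -/
theorem ofReal_notMem_filledJulia {P : ℂ → ℂ} {f : ℝ → ℝ} (hPf : ∀ x : ℝ, P x = f x) {w δ : ℝ}
    (hδ : 0 < δ) (hf : ∀ x ≤ w, f x ≤ x - δ) : (w : ℂ) ∉ filledJulia P := by
  intro hw
  obtain ⟨C, hC⟩ := mem_filledJulia_iff.mp hw
  have hiter (n : ℕ) : P^[n] w = (f^[n] w : ℝ) := by
    induction n with
    | zero => rfl
    | succ n ih => rw [Function.iterate_succ_apply', Function.iterate_succ_apply', ih, hPf]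
  have hle (n : ℕ) : f^[n] w ≤ w - n * δ := by
    induction n with
    | zero => simp
    | succ n ih =>
      rw [Function.iterate_succ_apply']
      have h0 : 0 ≤ n * δ := by positivity
      have := hf (f^[n] w) (by linarith)
      push_cast
      linarith
  obtain ⟨n, hn⟩ := exists_nat_gt ((C + w) / δ)
  rw [div_lt_iff₀ hδ] at hn
  have h1 := hC n
  rw [hiter, Complex.norm_real, Real.norm_eq_abs] at h1
  linarith [(abs_le.mp h1).1, hle n]

theorem two_mul_norm_le_norm_cubic {a b c : ℝ} (ha : 0 ≤ a) (hb : 0 ≤ b) (hc : 1 ≤ c) {z : ℂ}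
    (hz : a + b + 2 < ‖z‖) : 2 * ‖z‖ ≤ ‖(a * z + b * z ^ 2 + c * z ^ 3 : ℂ)‖ := by
  have h1 : ‖(c * z ^ 3 : ℂ)‖ = c * ‖z‖ ^ 3 := by
    rw [norm_mul, norm_pow, Complex.norm_of_nonneg (by linarith)]
  have h2 : ‖(a * z + b * z ^ 2 : ℂ)‖ ≤ a * ‖z‖ + b * ‖z‖ ^ 2 := by
    refine (norm_add_le _ _).trans_eq ?_
    rw [norm_mul, norm_mul, norm_pow, Complex.norm_of_nonneg ha, Complex.norm_of_nonneg hb]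
  have h3 : ‖(c * z ^ 3 : ℂ)‖ - ‖(a * z + b * z ^ 2 : ℂ)‖ ≤
      ‖(a * z + b * z ^ 2 + c * z ^ 3 : ℂ)‖ := by
    rw [add_comm (a * z + b * z ^ 2 : ℂ)]
    exact norm_sub_le_norm_add _ _
  have h4 : 0 ≤ ‖z‖ := norm_nonneg z
  have h5 : a + 2 ≤ c * ‖z‖ ^ 2 - b * ‖z‖ := by
    nlinarith [mul_nonneg (sub_nonneg.mpr hc) (sq_nonneg ‖z‖), mul_nonneg h4 (sub_nonneg.mpr hz.le)]
  nlinarith [mul_le_mul_of_nonneg_left h5 h4]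

/-- The nonzero fixed points `r < q` of `x ↦ a x + b x² + c x³` and the multiplier
`3 - 2a - b q` of `q`. -/
theorem exists_fixedPts_cubic {a b c : ℝ} (ha : 2 < a) (hb : 0 ≤ b) (hc : 0 < c)
    (hlow : 4 * c * (a - 1) < b ^ 2) (hhigh : b ^ 2 * (a - 2) < c * (2 * a - 3) ^ 2) :
    ∃ q r : ℝ, r < q ∧ q < 0 ∧ c * (q + r) = -b ∧ c * (q * r) = a - 1 ∧
      2 * a - 3 < -(b * q) ∧ -(b * q) < 2 * a - 2 := by
  obtain ⟨d, hd, hd2⟩ : ∃ d : ℝ, 0 < d ∧ d ^ 2 = b ^ 2 - 4 * c * (a - 1) :=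
    ⟨√(b ^ 2 - 4 * c * (a - 1)), Real.sqrt_pos.mpr (by linarith), Real.sq_sqrt (by linarith)⟩
  have hca : 0 < c * (a - 1) := mul_pos hc (by linarith)
  have hdb : d < b := lt_of_pow_lt_pow_left₀ 2 hb (by linarith)
  have hdc : d ^ 2 * (a - 2) < c := by rw [hd2]; linarith
  have hbd : b * d < d ^ 2 + 2 * c := by
    refine lt_of_pow_lt_pow_left₀ 2 (by positivity) ?_
    have : (d ^ 2 + 2 * c) ^ 2 - (b * d) ^ 2 = 4 * c * (c - d ^ 2 * (a - 2)) := by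
      rw [mul_pow b d, show b ^ 2 = d ^ 2 + 4 * c * (a - 1) by linarith]; ring
    nlinarith [mul_pos hc (sub_pos.mpr hdc)]
  have hbq : -(b * ((-b + d) / (2 * c))) = (b ^ 2 - b * d) / (2 * c) := by ring
  refine ⟨(-b + d) / (2 * c), (-b - d) / (2 * c), ?_, ?_, ?_, ?_, ?_, ?_⟩
  · gcongr; linarith
  · exact div_neg_of_neg_of_pos (by linarith) (by linarith)
  · field_simp; ring
  · field_simp; linarith
  · rw [hbq, lt_div_iff₀ (by linarith)]; linarith
  · rw [hbq, div_lt_iff₀ (by linarith)]; nlinarith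

/-- A real cubic takes the same value at `x + i y` and `-b / c - 2 x` if `P'(x) = c y²`. -/
theorem cubic_apply_eq_of_deriv_eq {a b c : ℝ} {P : ℂ → ℂ}
    (hP : ∀ z, P z = a * z + b * z ^ 2 + c * z ^ 3) (hc : c ≠ 0) {z : ℂ}
    (hz : a + 2 * b * z.re + 3 * c * z.re ^ 2 = c * z.im ^ 2) :
    P z = P ((-b / c - 2 * z.re : ℝ) : ℂ) := by
  obtain ⟨x, y⟩ := z
  simp only at hz ⊢
  have ha : a = c * y ^ 2 - 2 * b * x - 3 * c * x ^ 2 := by linarith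
  rw [hP, hP, ha, Complex.mk_eq_add_mul_I]
  push_cast
  have hc' : (c : ℂ) ≠ 0 := by exact_mod_cast hc
  field_simp
  ring_nf
  simp only [Complex.I_sq, Complex.I_pow_three]
  ring

theorem isFixedPt_cubic {a b c q r : ℝ} {P : ℂ → ℂ}
    (hP : ∀ z, P z = a * z + b * z ^ 2 + c * z ^ 3) (hsum : c * (q + r) = -b)
    (hprod : c * (q * r) = a - 1) : Function.IsFixedPt P q := by
  have h : a * q + b * q ^ 2 + c * q ^ 3 = q := by
    linear_combination q ^ 2 * hsum - q * hprod
  rw [Function.IsFixedPt, hP]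
  exact_mod_cast h

theorem interior_filledJulia_cubic_nonempty {a b c q r : ℝ} {P : ℂ → ℂ}
    (hP : ∀ z, P z = a * z + b * z ^ 2 + c * z ^ 3) (hsum : c * (q + r) = -b)
    (hprod : c * (q * r) = a - 1) (hlow : 2 * a - 3 < -(b * q)) (hhigh : -(b * q) < 2 * a - 2) :
    (interior (filledJulia P)).Nonempty := by
  set g : ℂ → ℂ := fun z => a + b * (z + q) + c * (z ^ 2 + z * q + q ^ 2) with hg
  have hgq : g q = (3 - 2 * a - b * q : ℝ) := by
    have h : a + b * (q + q) + c * (q ^ 2 + q * q + q ^ 2) = 3 - 2 * a - b * q := by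
      linear_combination 3 * q * hsum - 3 * hprod
    rw [← h, hg]
    push_cast
    ring
  have hlt : ‖g q‖ < 1 := by
    rw [hgq, Complex.norm_real, Real.norm_eq_abs, abs_lt]
    constructor <;> linarith
  have hgc : Continuous fun z => ‖g z‖ := by fun_prop
  obtain ⟨ε, hε, hball⟩ := Metric.mem_nhds_iff.mp ((isOpen_gt' 1).preimage hgc |>.mem_nhds hlt)
  refine interior_filledJulia_nonempty (q := q) hε fun z hz => ?_
  have hfac : P z - q = g z * (z - q) := by
    have hq := isFixedPt_cubic hP hsum hprod
    rw [Function.IsFixedPt, hP] at hq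
    rw [hP, hg]
    linear_combination hq
  rw [hfac, norm_mul]
  exact mul_le_of_le_one_left (norm_nonneg _) (hball hz).le

theorem not_isPreconnected_frontier_filledJulia_cubic {a b c q r : ℝ} {P : ℂ → ℂ}
    (hP : ∀ z, P z = a * z + b * z ^ 2 + c * z ^ 3) (ha : 4 ≤ a) (hb : 0 < b) (hc : 0 < c)
    (hK : IsCompact (filledJulia P)) (hrq : r < q) (hq : q < 0) (hsum : c * (q + r) = -b)
    (hprod : c * (q * r) = a - 1) (hdisc : 4 * c * (a - 1) < b ^ 2)
    (hcrit : a + 3 < -(b * q)) : ¬ IsPreconnected (frontier (filledJulia P)) := by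
  have hlin : Continuous fun z : ℂ => 3 * c * z.re + b := by fun_prop
  have hquad : Continuous fun z : ℂ => a + 2 * b * z.re + 3 * c * z.re ^ 2 := by fun_prop
  have him : Continuous fun z : ℂ => c * z.im ^ 2 := by fun_prop
  refine hK.not_isPreconnected_frontier
    (A := {z | 0 < 3 * c * z.re + b ∧ c * z.im ^ 2 < a + 2 * b * z.re + 3 * c * z.re ^ 2})
    (B := {z | 3 * c * z.re + b < 0 ∨ a + 2 * b * z.re + 3 * c * z.re ^ 2 < c * z.im ^ 2})
    ((isOpen_lt continuous_const hlin).and (isOpen_lt him hquad))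
    ((isOpen_lt hlin continuous_const).union (isOpen_lt hquad him))
    (Set.disjoint_left.mpr fun z hA hB => ?_) (fun z hz => ?_)
    ⟨0, mem_filledJulia_of_isFixedPt (by simp [Function.IsFixedPt, hP]), by
      simpa using ⟨hb, by linarith⟩⟩
    ⟨r, mem_filledJulia_of_isFixedPt
      (isFixedPt_cubic hP (add_comm q r ▸ hsum) (mul_comm q r ▸ hprod)), Or.inl ?_⟩
  · exact hB.elim (fun h => lt_asymm h hA.1) fun h => lt_asymm h hA.2
  · by_contra hAB
    simp only [Set.mem_union, Set.mem_ofPred_eq, not_or, not_and, not_lt] at hAB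
    obtain ⟨hA, hx, hy⟩ := hAB
    set x := z.re
    have hnn : 0 ≤ c * z.im ^ 2 := by positivity
    have hx0 : 0 < 3 * c * x + b := by
      refine hx.lt_of_ne fun h => ?_
      have : 3 * c * (a + 2 * b * x + 3 * c * x ^ 2) = 3 * c * a - b ^ 2 := by
        linear_combination -(3 * c * x + b) * h
      nlinarith [mul_nonneg hc.le (sub_nonneg.mpr ha), mul_nonneg hc.le (hnn.trans hy)]
    have hcurve : a + 2 * b * x + 3 * c * x ^ 2 = c * z.im ^ 2 := le_antisymm (hA hx0) hy
    have hqx : q / 2 < x := by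
      by_contra! hle
      have hval : a + 2 * b * (q / 2) + 3 * c * (q / 2) ^ 2 = (a + 3 + b * q) / 4 := by
        linear_combination 3 / 4 * q * hsum - 3 / 4 * hprod
      nlinarith [mul_nonneg (sub_nonneg.mpr hle) hx0.le, mul_nonneg hc.le (sq_nonneg (q / 2 - x))]
    have hmem := mem_filledJulia_of_apply_eq hz (cubic_apply_eq_of_deriv_eq hP hc.ne' hcurve)
    set w := -b / c - 2 * x with hw_def
    have hw : w < r := by
      have : -b / c = q + r := by rw [← hsum]; field_simp
      rw [hw_def, this]
      linarith
    refine ofReal_notMem_filledJulia (f := fun t => a * t + b * t ^ 2 + c * t ^ 3)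
      (δ := c * (-w * ((q - w) * (r - w)))) (fun t => by rw [hP]; push_cast; rfl) ?_ ?_ hmem
    · exact mul_pos hc (mul_pos (by linarith) (mul_pos (by linarith) (by linarith)))
    · intro t ht
      have hfac : a * t + b * t ^ 2 + c * t ^ 3 = t - c * (-t * ((q - t) * (r - t))) := by
        linear_combination t ^ 2 * hsum - t * hprod
      simp only [hfac]
      have h1 : 0 < -w := by linarith
      have h2 : 0 < q - w := by linarith
      have h3 : 0 < r - w := by linarith
      have h4 : 0 ≤ q - t := by linarith
      have h5 : 0 ≤ -t := by linarith
      gcongr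
  · rw [Complex.ofReal_re]
    nlinarith [mul_pos hc (sub_pos.mpr hrq), mul_pos hc (neg_pos.mpr (hrq.trans hq))]

/-- A real cubic with an attracting fixed point and an escaping critical point has a disconnected
Julia set that is not totally disconnected. -/
theorem frontier_filledJulia_cubic {a b c : ℝ} {P : ℂ → ℂ}
    (hP : ∀ z, P z = a * z + b * z ^ 2 + c * z ^ 3) (ha : 6 ≤ a) (hb : 0 < b) (hc : 1 ≤ c)
    (hlow : 4 * c * (a - 1) < b ^ 2) (hhigh : b ^ 2 * (a - 2) < c * (2 * a - 3) ^ 2) :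
    ¬ IsPreconnected (frontier (filledJulia P)) ∧
      ¬ IsTotallyDisconnected (frontier (filledJulia P)) := by
  have hc0 : 0 < c := by linarith
  have hcont : Continuous P := by
    rw [funext hP]
    fun_prop
  have hK : IsCompact (filledJulia P) :=
    isCompact_filledJulia hcont (R := a + b + 2) (by linarith) fun z hz => by
      rw [hP]
      exact two_mul_norm_le_norm_cubic (by linarith) hb.le hc hz
  obtain ⟨q, r, hrq, hq, hsum, hprod, h1, h2⟩ :=
    exists_fixedPts_cubic (by linarith) hb.le hc0 hlow hhigh
  exact ⟨not_isPreconnected_frontier_filledJulia_cubic hP (by linarith) hb hc0 hK hrq hq hsum hprod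
      hlow (by linarith),
    hK.not_isTotallyDisconnected_frontier
      (interior_filledJulia_cubic_nonempty hP hsum hprod h1 h2)⟩

section IndependentSets

open Finset

variable {V : Type*} [Fintype V] [DecidableEq V] (G : SimpleGraph V) [DecidableRel G.Adj]

/-- The number of independent sets with `k` vertices. -/
def indepCount (k : ℕ) : ℕ :=
  #{s : Finset V | #s = k ∧ ∀ u ∈ s, ∀ v ∈ s, ¬ G.Adj u v}

theorem indepCount_le_choose (k : ℕ) : indepCount G k ≤ (Fintype.card V).choose k := by
  rw [← card_univ, ← card_powersetCard]
  exact card_le_card fun s hs => by simpa using (mem_filter.mp hs).2.1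

/-- If only one pair of vertices is adjacent, deleting a vertex of it leaves an independent set. -/
theorem exists_indep_of_indepCount_two {n : ℕ} (hn : n + 1 = Fintype.card V)
    (h : indepCount G 2 + 1 = (n + 1).choose 2) :
    ∃ s : Finset V, #s = n ∧ ∀ u ∈ s, ∀ v ∈ s, ¬ G.Adj u v := by
  have hsub : ({s : Finset V | #s = 2 ∧ ∀ u ∈ s, ∀ v ∈ s, ¬ G.Adj u v} : Finset (Finset V)) ⊆
      powersetCard 2 univ := fun s hs => by simpa using (mem_filter.mp hs).2.1
  have hcard : #(powersetCard 2 (univ : Finset V) \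
      ({s : Finset V | #s = 2 ∧ ∀ u ∈ s, ∀ v ∈ s, ¬ G.Adj u v} : Finset (Finset V))) = 1 := by
    rw [card_sdiff_of_subset hsub, card_powersetCard, card_univ, ← hn, ← h]
    exact Nat.add_sub_cancel_left (indepCount G 2) 1
  obtain ⟨e, he⟩ := card_eq_one.mp hcard
  have he2 : #e = 2 := by
    have : e ∈ ({e} : Finset (Finset V)) := mem_singleton_self e
    rw [← he, mem_sdiff, mem_powersetCard] at this
    exact this.1.2
  obtain ⟨x, hx⟩ : e.Nonempty := card_pos.mp (by omega)
  refine ⟨univ.erase x, by rw [card_erase_of_mem (mem_univ x), card_univ]; omega, ?_⟩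
  intro u hu v hv huv
  have hmem : ({u, v} : Finset V) ∈ ({e} : Finset (Finset V)) := by
    rw [← he, mem_sdiff, mem_powersetCard, mem_filter]
    exact ⟨⟨subset_univ _, card_pair huv.ne⟩, fun h => h.2.2 u (by simp) v (by simp) huv⟩
  rw [← mem_singleton.mp hmem, mem_insert, mem_singleton] at hx
  exact hx.elim (fun h => (mem_erase.mp hu).1 h.symm) fun h => (mem_erase.mp hv).1 h.symm

end IndependentSets


/-- For a finite simple graph with independence number 3 whose reduced
independence polynomial is `P(z) = a₁z + a₂z² + a₃z³`, if `a₁ ≥ 4` and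
`4·a₃·(a₁−1)·(a₁−2) < a₂²·(a₁−2) < a₃·(2a₁−3)²`, then the Julia set of `P` is not
connected but not totally disconnected. -/
theorem stmt_6 {V : Type*} [Fintype V] [DecidableEq V]
    (G : SimpleGraph V) [DecidableRel G.Adj]
    (a₁ a₂ a₃ : ℕ)
    (ha₁ : a₁ = Fintype.card V)
    (ha₂ : a₂ = (Finset.univ.filter
      (fun s : Finset V => s.card = 2 ∧ ∀ u ∈ s, ∀ v ∈ s, ¬ G.Adj u v)).card)
    (ha₃ : a₃ = (Finset.univ.filter
      (fun s : Finset V => s.card = 3 ∧ ∀ u ∈ s, ∀ v ∈ s, ¬ G.Adj u v)).card)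
    (hindep3 : ∃ s : Finset V, s.card = 3 ∧ ∀ u ∈ s, ∀ v ∈ s, ¬ G.Adj u v)
    (hindep4 : ¬ ∃ s : Finset V, s.card = 4 ∧ ∀ u ∈ s, ∀ v ∈ s, ¬ G.Adj u v)
    (P : ℂ → ℂ)
    (hP : ∀ z, P z = a₁ * z + a₂ * z ^ 2 + a₃ * z ^ 3)
    (ha : 4 ≤ a₁)
    (hlow : 4 * a₃ * ((a₁ : ℤ) - 1) * ((a₁ : ℤ) - 2) < (a₂ : ℤ) ^ 2 * ((a₁ : ℤ) - 2))
    (hhigh : (a₂ : ℤ) ^ 2 * ((a₁ : ℤ) - 2) < a₃ * (2 * (a₁ : ℤ) - 3) ^ 2) :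
    ¬ IsConnected
        (frontier {z : ℂ | Bornology.IsBounded (Set.range fun n => P^[n] z)}) ∧
      ∃ t ⊆ frontier {z : ℂ | Bornology.IsBounded (Set.range fun n => P^[n] z)},
        IsPreconnected t ∧ ∃ x ∈ t, ∃ y ∈ t, x ≠ y := by
  have hc : 1 ≤ a₃ := by
    obtain ⟨s, hs⟩ := hindep3
    rw [ha₃]
    exact Finset.card_pos.mpr ⟨s, by simpa using hs⟩
  have hb_choose : a₂ ≤ a₁.choose 2 := by
    rw [ha₁, ha₂]
    exact indepCount_le_choose G 2
  have ha6 : 6 ≤ a₁ := by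
    by_contra! hlt
    interval_cases a₁
    · have : a₂ ≤ 6 := hb_choose
      norm_num at hlow hhigh
      interval_cases a₂ <;> omega
    · have : a₂ ≤ 10 := hb_choose
      have h9 : a₂ ≠ 9 := fun h => hindep4
        (exists_indep_of_indepCount_two G ha₁ (congrArg (· + 1) (ha₂.symm.trans h)))
      norm_num at hlow hhigh
      interval_cases a₂ <;> omega
  have ha6' : (6 : ℝ) ≤ a₁ := by exact_mod_cast ha6
  have hlow' : 4 * (a₃ : ℝ) * (a₁ - 1) * (a₁ - 2) < a₂ ^ 2 * (a₁ - 2) := by exact_mod_cast hlow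
  have hhigh' : (a₂ : ℝ) ^ 2 * (a₁ - 2) < a₃ * (2 * a₁ - 3) ^ 2 := by exact_mod_cast hhigh
  have hlow'' : 4 * (a₃ : ℝ) * (a₁ - 1) < a₂ ^ 2 := lt_of_mul_lt_mul_right hlow' (by linarith)
  have hb : (0 : ℝ) < a₂ := by
    refine (Nat.cast_nonneg a₂).lt_of_ne fun h => ?_
    rw [← h] at hlow''
    nlinarith [mul_nonneg (Nat.cast_nonneg (α := ℝ) a₃) (by linarith : (0 : ℝ) ≤ a₁ - 1)]
  obtain ⟨h1, h2⟩ := frontier_filledJulia_cubic (by exact_mod_cast hP) ha6' hb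
    (by exact_mod_cast hc) hlow'' hhigh'
  refine ⟨fun h => h1 h.isPreconnected, ?_⟩
  by_contra! h
  exact h2 fun t ht hpre x hx y hy => h t ht hpre x hx y hy
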